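/- For every fixed ω > 0, the function λ ↦ K(λ, ω) is differentiable on ℝ, and for all η > 0 and λ ∈ ℝ the GIG distribution satisfies E[log W] = ∫₀^∞ log(w) · h(w | ω, η, λ) dw = log η + (∂/∂λ K(λ, ω)) / K(λ, ω). -/

import Mathlib

open MeasureTheory Real

/-- The modified Bessel function of the third kind (Watson's integral representation). -/
noncomputable def besselK (lam ω : ℝ) : ℝ :=
  ∫ t in Set.Ioi (0 : ℝ), Real.exp (-ω * Real.cosh t) * Real.cosh (lam * t)

/-- The generalized inverse Gaussian density with concentration `ω`, scale `η`, index `lam`. -/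
noncomputable def gigDensity (ω η lam w : ℝ) : ℝ :=
  (w / η) ^ (lam - 1) / (2 * η * besselK lam ω) * Real.exp (-(ω / 2) * (w / η + η / w))

/-- For fixed `ω`, the unnormalized GIG law of `log W` at index `0` and scale `1`. -/
noncomputable def expNegCoshMeasure (ω : ℝ) : Measure ℝ :=
  volume.withDensity fun t => ENNReal.ofReal (exp (-ω * cosh t))

lemma measurable_ofReal_exp_neg_mul_cosh (ω : ℝ) :
    Measurable fun t : ℝ => ENNReal.ofReal (exp (-ω * cosh t)) := by
  fun_prop

lemma one_add_sq_div_two_le_cosh (t : ℝ) : 1 + t ^ 2 / 2 ≤ cosh t := by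
  have h : cosh t = 1 + 2 * sinh (t / 2) ^ 2 := by
    have h₁ := cosh_two_mul (t / 2)
    have h₂ := cosh_sq (t / 2)
    rw [mul_div_cancel₀ t two_ne_zero] at h₁
    linarith
  have hs : (t / 2) ^ 2 ≤ sinh (t / 2) ^ 2 := by
    rw [sq_le_sq, abs_sinh]
    exact self_le_sinh_iff.2 (abs_nonneg _)
  rw [h]
  linarith

lemma integrable_exp_neg_mul_cosh_mul_exp {ω : ℝ} (hω : 0 < ω) (l : ℝ) :
    Integrable fun t : ℝ => exp (-ω * cosh t) * exp (l * t) := by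
  refine ((integrable_exp_neg_mul_sq (b := ω / 4) (by positivity)).const_mul
    (exp (l ^ 2 / ω))).mono' (by fun_prop) (ae_of_all _ fun t => ?_)
  rw [norm_of_nonneg (by positivity), ← exp_add, ← exp_add, exp_le_exp]
  have hc := mul_le_mul_of_nonneg_left (one_add_sq_div_two_le_cosh t) hω.le
  have hsq : l ^ 2 / ω + ω / 4 * t ^ 2 - l * t = (l - ω / 2 * t) ^ 2 / ω := by
    field_simp
    ring
  have hpos : 0 ≤ (l - ω / 2 * t) ^ 2 / ω := by positivity
  linarith

lemma integrable_expNegCoshMeasure_iff (ω : ℝ) (f : ℝ → ℝ) :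
    Integrable f (expNegCoshMeasure ω) ↔ Integrable fun t => exp (-ω * cosh t) * f t := by
  rw [expNegCoshMeasure, integrable_withDensity_iff_integrable_smul'
    (measurable_ofReal_exp_neg_mul_cosh ω) (by simp)]
  simp [ENNReal.toReal_ofReal (exp_pos _).le]

lemma integral_expNegCoshMeasure (ω : ℝ) (f : ℝ → ℝ) :
    ∫ t, f t ∂expNegCoshMeasure ω = ∫ t, exp (-ω * cosh t) * f t := by
  rw [expNegCoshMeasure, integral_withDensity_eq_integral_toReal_smul
    (measurable_ofReal_exp_neg_mul_cosh ω) (by simp)]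
  simp [ENNReal.toReal_ofReal (exp_pos _).le]

lemma integrableExpSet_expNegCoshMeasure {ω : ℝ} (hω : 0 < ω) :
    ProbabilityTheory.integrableExpSet id (expNegCoshMeasure ω) = Set.univ :=
  Set.eq_univ_of_forall fun l => (integrable_expNegCoshMeasure_iff ω _).2
    (integrable_exp_neg_mul_cosh_mul_exp hω l)

lemma integrable_exp_neg_mul_cosh_mul_self_mul_exp {ω : ℝ} (hω : 0 < ω) (l : ℝ) :
    Integrable fun t : ℝ => exp (-ω * cosh t) * (t * exp (l * t)) := by
  have h := ProbabilityTheory.integrable_pow_mul_exp_of_mem_interior_integrableExpSet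
    (X := id) (μ := expNegCoshMeasure ω) (v := l)
    (by simp [integrableExpSet_expNegCoshMeasure hω]) 1
  simpa using (integrable_expNegCoshMeasure_iff ω _).1 h

lemma two_mul_besselK {ω : ℝ} (hω : 0 < ω) (l : ℝ) :
    2 * besselK l ω = ∫ t : ℝ, exp (-ω * cosh t) * exp (l * t) := by
  have hneg : ∫ t : ℝ, exp (-ω * cosh t) * exp (-l * t)
      = ∫ t : ℝ, exp (-ω * cosh t) * exp (l * t) := by
    rw [← integral_neg_eq_self]
    simp
  have habs := integral_comp_abs (f := fun t : ℝ => exp (-ω * cosh t) * cosh (l * t))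
  have heven (t : ℝ) : exp (-ω * cosh |t|) * cosh (l * |t|)
      = (exp (-ω * cosh t) * exp (l * t) + exp (-ω * cosh t) * exp (-l * t)) / 2 := by
    rw [cosh_abs, ← cosh_abs (l * |t|), abs_mul, abs_abs, ← abs_mul, cosh_abs, cosh_eq (l * t)]
    ring_nf
  simp only [heven] at habs
  rw [besselK, ← habs, integral_div, integral_add (integrable_exp_neg_mul_cosh_mul_exp hω l)
    (integrable_exp_neg_mul_cosh_mul_exp hω (-l)), hneg]
  ring

lemma hasDerivAt_besselK {ω : ℝ} (hω : 0 < ω) (l : ℝ) :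
    HasDerivAt (fun x => besselK x ω)
      ((∫ t : ℝ, exp (-ω * cosh t) * (t * exp (l * t))) / 2) l := by
  have h := ProbabilityTheory.hasDerivAt_mgf (X := id) (μ := expNegCoshMeasure ω) (t := l)
    (by simp [integrableExpSet_expNegCoshMeasure hω])
  rw [integral_expNegCoshMeasure] at h
  refine (h.div_const 2).congr_of_eventuallyEq (.of_forall fun x => ?_)
  simp only [ProbabilityTheory.mgf, integral_expNegCoshMeasure, id]
  rw [← two_mul_besselK hω]
  ring

lemma besselK_pos {ω : ℝ} (hω : 0 < ω) (l : ℝ) : 0 < besselK l ω := by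
  have h : 0 < ∫ t : ℝ, exp (-ω * cosh t) * exp (l * t) := by
    rw [integral_pos_iff_support_of_nonneg (fun t => by positivity)
      (integrable_exp_neg_mul_cosh_mul_exp hω l)]
    have hs : (Function.support fun t : ℝ => exp (-ω * cosh t) * exp (l * t)) = Set.univ :=
      Set.eq_univ_of_forall fun t => (by positivity : exp (-ω * cosh t) * exp (l * t) ≠ 0)
    rw [hs, volume_univ]
    exact ENNReal.zero_lt_top
  linarith [two_mul_besselK hω l]

lemma integral_Ioi_eq_integral_mul_exp {η : ℝ} (hη : 0 < η) (f : ℝ → ℝ) :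
    ∫ w in Set.Ioi (0 : ℝ), f w = ∫ s : ℝ, η * exp s * f (η * exp s) := by
  have himg : (fun s : ℝ => η * exp s) '' Set.univ = Set.Ioi 0 := by
    ext w
    simp only [Set.image_univ, Set.mem_range, Set.mem_Ioi]
    refine ⟨?_, fun hw => ⟨log (w / η), ?_⟩⟩
    · rintro ⟨s, rfl⟩
      positivity
    · rw [exp_log (by positivity), mul_div_cancel₀ w hη.ne']
  rw [← himg, integral_image_eq_integral_abs_deriv_smul (f' := fun s => η * exp s)
    MeasurableSet.univ (fun s _ => ((hasDerivAt_exp s).const_mul η).hasDerivWithinAt)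
    (fun s _ t _ h => exp_injective (mul_left_cancel₀ hη.ne' h)), setIntegral_univ]
  simp only [smul_eq_mul]
  congr! 3 with s
  exact abs_of_pos (by positivity)

lemma mul_exp_mul_log_mul_gigDensity (ω l s : ℝ) {η : ℝ} (hη : 0 < η) :
    η * exp s * (log (η * exp s) * gigDensity ω η l (η * exp s))
      = (log η * (exp (-ω * cosh s) * exp (l * s)) + exp (-ω * cosh s) * (s * exp (l * s)))
        / (2 * besselK l ω) := by
  have hrpow : exp s ^ (l - 1) = exp (l * s) / exp s := by
    rw [← exp_mul, ← exp_sub]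
    ring_nf
  have hcosh : -(ω / 2) * (exp s + η / (η * exp s)) = -ω * cosh s := by
    rw [cosh_eq, exp_neg]
    field_simp
  rw [gigDensity, mul_div_cancel_left₀ _ hη.ne', hcosh, hrpow,
    log_mul hη.ne' (exp_pos s).ne', log_exp]
  field_simp

/-- For fixed `ω > 0`, `λ ↦ K(λ, ω)` is differentiable, and the GIG distribution satisfies
`E[log W] = log η + (∂/∂λ K(λ, ω)) / K(λ, ω)`. -/
theorem gig_log_expectation (ω : ℝ) (hω : 0 < ω) :
    Differentiable ℝ (fun lam => besselK lam ω) ∧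
    ∀ η lam : ℝ, 0 < η →
      ∫ w in Set.Ioi (0 : ℝ), Real.log w * gigDensity ω η lam w
        = Real.log η + deriv (fun l => besselK l ω) lam / besselK lam ω := by
  refine ⟨fun l => (hasDerivAt_besselK hω l).differentiableAt, fun η l hη => ?_⟩
  have hK := (besselK_pos hω l).ne'
  rw [(hasDerivAt_besselK hω l).deriv, integral_Ioi_eq_integral_mul_exp hη]
  simp only [mul_exp_mul_log_mul_gigDensity ω l _ hη]
  rw [integral_div, integral_add ((integrable_exp_neg_mul_cosh_mul_exp hω l).const_mul _)
    (integrable_exp_neg_mul_cosh_mul_self_mul_exp hω l), integral_const_mul, ← two_mul_besselK hω]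
  rw [add_div, mul_div_assoc, div_self (mul_ne_zero two_ne_zero hK), mul_one, div_div]
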